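/- Let δ > 0 and let b0, b1, b2, b3 : {v : 0 < |v| < δ} → ℝ be functions such that for every v in the domain: N(v, b0(v), b1(v), b2(v), b3(v)) = 0, (∂N/∂v)(v, b0(v), b1(v), b2(v), b3(v)) = 0, (∂²N/∂v²)(v, b0(v), b1(v), b2(v), b3(v)) = 0, and b0(v) = 5 - 2·b1(v) - 2·b2(v) - 2·b3(v). Then (b3(v) - 17671/12096)/v^2 → -45767/241920 as v → 0 with v ≠ 0; that is, the second-order Taylor coefficient at v = 0 of the b3-coefficient of the method with zero phase-lag and zero first and second derivatives of the phase-lag equals -45767/241920. -/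

import Mathlib

/-- Phase-lag numerator of the symmetric 8-step method. -/
noncomputable def N (v b0 b1 b2 b3 : ℝ) : ℝ :=
  16 * Real.cos v ^ 4 + (8 * b3 * v ^ 2 - 16) * Real.cos v ^ 3
    + (4 * b2 * v ^ 2 - 8) * Real.cos v ^ 2
    + (10 + (2 * b1 - 6 * b3) * v ^ 2) * Real.cos v - 2
    + (b0 - 2 * b2) * v ^ 2

open Real Filter Topology

theorem exists_cos_taylor_remainder (a : ℝ) :
    ∃ r : ℝ → ℝ, ContinuousAt r 0 ∧ r 0 = 0 ∧ ∀ x, cos (a * x) =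
      1 - (a * x) ^ 2 / 2 + (a * x) ^ 4 / 24 - (a * x) ^ 6 / 720 + (a * x) ^ 8 / 40320
        - (a * x) ^ 10 / 3628800 + (a * x) ^ 12 / 479001600 + x ^ 13 * r x := by
  have h := Real.taylor_tendsto (f := fun x => cos (a * x)) (x₀ := 0) (n := 13) convex_univ
    (Set.mem_univ _) (by fun_prop)
  rw [nhdsWithin_univ] at h
  set r := fun x : ℝ => (cos (a * x) -
    taylorWithinEval (fun x => cos (a * x)) 13 Set.univ 0 x) / (x - 0) ^ 13 with hr
  have hr0 : r 0 = 0 := by simp [hr]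
  refine ⟨r, by rwa [ContinuousAt, hr0], hr0, fun x => ?_⟩
  rcases eq_or_ne x 0 with rfl | hx
  · simp
  · simp only [hr, taylor_within_apply, iteratedDerivWithin_univ,
      iteratedDeriv_comp_const_mul contDiff_cos]
    simp [Finset.sum_range_succ, iteratedDeriv_succ, Nat.factorial]
    field_simp
    ring

theorem exists_sin_taylor_remainder (a : ℝ) :
    ∃ r : ℝ → ℝ, ContinuousAt r 0 ∧ r 0 = 0 ∧ ∀ x, sin (a * x) =
      a * x - (a * x) ^ 3 / 6 + (a * x) ^ 5 / 120 - (a * x) ^ 7 / 5040 + (a * x) ^ 9 / 362880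
        - (a * x) ^ 11 / 39916800 + (a * x) ^ 13 / 6227020800 + x ^ 13 * r x := by
  have h := Real.taylor_tendsto (f := fun x => sin (a * x)) (x₀ := 0) (n := 13) convex_univ
    (Set.mem_univ _) (by fun_prop)
  rw [nhdsWithin_univ] at h
  set r := fun x : ℝ => (sin (a * x) -
    taylorWithinEval (fun x => sin (a * x)) 13 Set.univ 0 x) / (x - 0) ^ 13 with hr
  have hr0 : r 0 = 0 := by simp [hr]
  refine ⟨r, by rwa [ContinuousAt, hr0], hr0, fun x => ?_⟩
  rcases eq_or_ne x 0 with rfl | hx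
  · simp
  · simp only [hr, taylor_within_apply, iteratedDerivWithin_univ,
      iteratedDeriv_comp_const_mul contDiff_sin]
    simp [Finset.sum_range_succ, iteratedDeriv_succ, Nat.factorial]
    field_simp
    ring

theorem hasDerivAt_N (v b0 b1 b2 b3 : ℝ) :
    HasDerivAt (fun w => N w b0 b1 b2 b3)
      (v ^ 2 * (-sin v * (2 * b3 * (12 * cos v ^ 2 - 3) + 2 * b2 * (4 * cos v) + 2 * b1))
        + 2 * v * (2 * b3 * (4 * cos v ^ 3 - 3 * cos v) + 2 * b2 * (2 * cos v ^ 2 - 1)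
          + 2 * b1 * cos v + b0)
        - sin v * (64 * cos v ^ 3 - 48 * cos v ^ 2 - 16 * cos v + 10)) v := by
  have hc := hasDerivAt_cos v
  have hv := hasDerivAt_id' v
  have hN : (fun w => N w b0 b1 b2 b3) = fun w =>
      w ^ 2 * (2 * b3 * (4 * cos w ^ 3 - 3 * cos w) + 2 * b2 * (2 * cos w ^ 2 - 1)
        + 2 * b1 * cos w + b0)
      + (16 * cos w ^ 4 - 16 * cos w ^ 3 - 8 * cos w ^ 2 + 10 * cos w - 2) := by
    funext w
    unfold N
    ring
  rw [hN]
  have hp := (((((hc.pow 3).const_mul 4).sub (hc.const_mul 3)).const_mul (2 * b3)).add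
    ((((hc.pow 2).const_mul 2).sub_const 1).const_mul (2 * b2))).add
      (hc.const_mul (2 * b1)) |>.add_const b0
  have ha := ((((hc.pow 4).const_mul 16).sub ((hc.pow 3).const_mul 16)).sub
    ((hc.pow 2).const_mul 8)).add (hc.const_mul 10) |>.sub_const 2
  refine (((hv.pow 2).mul hp).add ha).congr_deriv ?_
  simp
  ring

theorem iteratedDeriv_two_N (v b0 b1 b2 b3 : ℝ) :
    iteratedDeriv 2 (fun w => N w b0 b1 b2 b3) v =
      v ^ 2 * (sin v ^ 2 * (2 * b3 * (24 * cos v) + 8 * b2)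
          - cos v * (2 * b3 * (12 * cos v ^ 2 - 3) + 2 * b2 * (4 * cos v) + 2 * b1))
        + 4 * v * (-sin v * (2 * b3 * (12 * cos v ^ 2 - 3) + 2 * b2 * (4 * cos v) + 2 * b1))
        + 2 * (2 * b3 * (4 * cos v ^ 3 - 3 * cos v) + 2 * b2 * (2 * cos v ^ 2 - 1)
          + 2 * b1 * cos v + b0)
        + (sin v ^ 2 * (192 * cos v ^ 2 - 96 * cos v - 16)
          - cos v * (64 * cos v ^ 3 - 48 * cos v ^ 2 - 16 * cos v + 10)) := by
  rw [iteratedDeriv_succ, iteratedDeriv_one, funext fun w => (hasDerivAt_N w b0 b1 b2 b3).deriv]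
  have hc := hasDerivAt_cos v
  have hs := hasDerivAt_sin v
  have hv := hasDerivAt_id' v
  have hd := ((hc.pow 2).const_mul 12).sub_const 3 |>.const_mul (2 * b3) |>.add
    ((hc.const_mul 4).const_mul (2 * b2)) |>.add_const (2 * b1)
  have hp := (((((hc.pow 3).const_mul 4).sub (hc.const_mul 3)).const_mul (2 * b3)).add
    ((((hc.pow 2).const_mul 2).sub_const 1).const_mul (2 * b2))).add
      (hc.const_mul (2 * b1)) |>.add_const b0
  have ha := (((hc.pow 3).const_mul 64).sub ((hc.pow 2).const_mul 48)).sub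
    (hc.const_mul 16) |>.add_const 10
  refine ((((hv.pow 2).mul (hs.neg.mul hd)).add ((hv.const_mul 2).mul hp)).sub
    (hs.mul ha)).deriv.trans ?_
  simp
  ring

/-- If `v² (p + 5) + a` vanishes at `v` to second order, where `p` is a cubic polynomial in `cos v`
without constant term in `1 - cos v`, then the leading coefficient of `p` is determined by the
values `A`, `A1`, `A2` of `a` and its first two derivatives. -/
theorem leading_coeff_elimination {v c s b0 b1 b2 b3 A A1 A2 P P1 P2 : ℝ}
    (hs : s ^ 2 = 1 - c ^ 2) (h : b0 = 5 - 2 * b1 - 2 * b2 - 2 * b3)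
    (hP : P = 2 * b3 * (4 * c ^ 3 - 3 * c) + 2 * b2 * (2 * c ^ 2 - 1) + 2 * b1 * c + b0 - 5)
    (hP1 : P1 = -s * (2 * b3 * (12 * c ^ 2 - 3) + 2 * b2 * (4 * c) + 2 * b1))
    (hP2 : P2 = s ^ 2 * (2 * b3 * (24 * c) + 8 * b2)
      - c * (2 * b3 * (12 * c ^ 2 - 3) + 2 * b2 * (4 * c) + 2 * b1))
    (h0 : v ^ 2 * (P + 5) + A = 0) (h1 : v ^ 2 * P1 + 2 * v * (P + 5) + A1 = 0)
    (h2 : v ^ 2 * P2 + 4 * v * P1 + 2 * (P + 5) + A2 = 0) :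
    -16 * b3 * (1 - c) ^ 2 * s ^ 3 * v ^ 4 =
      (1 - c) * (s * (-A2 * v ^ 2 + 4 * A1 * v - 6 * A) - c * (-A1 * v ^ 2 + 2 * A * v))
        - 2 * s ^ 2 * (-A1 * v ^ 2 + 2 * A * v) + 2 * s * (1 + c) * (-A * v ^ 2 - 5 * v ^ 4) := by
  have e0 : A = -v ^ 2 * (P + 5) := by linear_combination h0
  have e1 : A1 = -(v ^ 2 * P1 + 2 * v * (P + 5)) := by linear_combination h1
  have e2 : A2 = -(v ^ 2 * P2 + 4 * v * P1 + 2 * (P + 5)) := by linear_combination h2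
  subst h e0 e1 e2 hP hP1 hP2
  grind

/-- The numerator, as a trigonometric sum with polynomial coefficients, of the closed form of
`b3 - 17671 / 12096`. -/
noncomputable def eliminatedNumerator (v : ℝ) : ℝ :=
  (15 * sin v - 9 * sin (2 * v) - 9 * sin (3 * v) + 18 * sin (4 * v)
        - 12 * sin (5 * v) + 3 * sin (6 * v))
    + (20 - 41 * cos v + 33 * cos (2 * v)
        - 3 * cos (3 * v) - 24 * cos (4 * v) + 20 * cos (5 * v) - 5 * cos (6 * v)) * v
    + (-24 * sin v + 33 * sin (2 * v) - 12 * sin (3 * v)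
        - 12 * sin (4 * v) + 12 * sin (5 * v) - 3 * sin (6 * v)) * v ^ 2
    + (9031/864 * sin v - 25231/1512 * sin (2 * v)
        - 17671/4032 * sin (3 * v) + 17671/3024 * sin (4 * v) - 17671/12096 * sin (5 * v)) * v ^ 4

/-- Elimination of `b0`, `b1`, `b2` from the three phase-lag conditions. -/
theorem b3_elimination {v b0 b1 b2 b3 : ℝ} (h0 : N v b0 b1 b2 b3 = 0)
    (h1 : deriv (fun w => N w b0 b1 b2 b3) v = 0)
    (h2 : iteratedDeriv 2 (fun w => N w b0 b1 b2 b3) v = 0)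
    (h : b0 = 5 - 2 * b1 - 2 * b2 - 2 * b3) :
    -16 * (b3 - 17671 / 12096) * ((1 - cos v) ^ 2 * sin v ^ 3 * v ^ 4) =
      eliminatedNumerator v := by
  rw [(hasDerivAt_N v b0 b1 b2 b3).deriv] at h1
  rw [iteratedDeriv_two_N] at h2
  unfold N at h0
  unfold eliminatedNumerator
  have hs : sin v ^ 2 = 1 - cos v ^ 2 := sin_sq v
  have c2 := cos_two_mul v
  have s2 := sin_two_mul v
  have c3 := cos_three_mul v
  have s3 := sin_three_mul v
  have c4 : cos (4 * v) = 2 * cos (2 * v) ^ 2 - 1 := by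
    rw [← cos_two_mul]; ring_nf
  have s4 : sin (4 * v) = 2 * sin (2 * v) * cos (2 * v) := by
    rw [← sin_two_mul]; ring_nf
  have c5 : cos (5 * v) = cos (2 * v) * cos (3 * v) - sin (2 * v) * sin (3 * v) := by
    rw [← cos_add]; ring_nf
  have s5 : sin (5 * v) = sin (2 * v) * cos (3 * v) + cos (2 * v) * sin (3 * v) := by
    rw [← sin_add]; ring_nf
  have c6 : cos (6 * v) = 2 * cos (3 * v) ^ 2 - 1 := by
    rw [← cos_two_mul]; ring_nf
  have s6 : sin (6 * v) = 2 * sin (3 * v) * cos (3 * v) := by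
    rw [← sin_two_mul]; ring_nf
  simp only [c6, s6, c5, s5, c4, s4, c3, s3, c2, s2]
  generalize cos v = c at *
  generalize sin v = s at *
  clear c2 s2 c3 s3 c4 s4 c5 s5 c6 s6
  subst h
  have e : -16 * b3 * (1 - c) ^ 2 * s ^ 3 * v ^ 4 =
      (1 - c) * (s * (-(s ^ 2 * (192 * c ^ 2 - 96 * c - 16)
          - c * (64 * c ^ 3 - 48 * c ^ 2 - 16 * c + 10)) * v ^ 2
          + 4 * (-s * (64 * c ^ 3 - 48 * c ^ 2 - 16 * c + 10)) * v
          - 6 * (16 * c ^ 4 - 16 * c ^ 3 - 8 * c ^ 2 + 10 * c - 2))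
        - c * (s * (64 * c ^ 3 - 48 * c ^ 2 - 16 * c + 10) * v ^ 2
          + 2 * (16 * c ^ 4 - 16 * c ^ 3 - 8 * c ^ 2 + 10 * c - 2) * v))
      - 2 * s ^ 2 * (s * (64 * c ^ 3 - 48 * c ^ 2 - 16 * c + 10) * v ^ 2
        + 2 * (16 * c ^ 4 - 16 * c ^ 3 - 8 * c ^ 2 + 10 * c - 2) * v)
      + 2 * s * (1 + c) * (-(16 * c ^ 4 - 16 * c ^ 3 - 8 * c ^ 2 + 10 * c - 2) * v ^ 2
        - 5 * v ^ 4) := by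
    refine (leading_coeff_elimination hs rfl rfl rfl rfl
      (A := 16 * c ^ 4 - 16 * c ^ 3 - 8 * c ^ 2 + 10 * c - 2)
      (A1 := -s * (64 * c ^ 3 - 48 * c ^ 2 - 16 * c + 10))
      (A2 := s ^ 2 * (192 * c ^ 2 - 96 * c - 16)
        - c * (64 * c ^ 3 - 48 * c ^ 2 - 16 * c + 10))
      (b1 := b1) (b2 := b2) ?_ ?_ ?_).trans (by ring)
    · linear_combination h0
    · linear_combination h1
    · linear_combination h2
  rw [show -16 * (b3 - 17671 / 12096) * ((1 - c) ^ 2 * s ^ 3 * v ^ 4) =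
    -16 * b3 * (1 - c) ^ 2 * s ^ 3 * v ^ 4 + 17671 / 756 * ((1 - c) ^ 2 * s ^ 3 * v ^ 4) by ring, e]
  clear h0 h1 h2 e
  grind

theorem tendsto_eliminated_numerator :
    Tendsto (fun v : ℝ => eliminatedNumerator v / v ^ 13) (𝓝[≠] 0) (𝓝 (45767 / 60480)) := by
  obtain ⟨p1, hp1, hp10, hc1⟩ := exists_cos_taylor_remainder 1
  obtain ⟨q1, hq1, hq10, hs1⟩ := exists_sin_taylor_remainder 1
  obtain ⟨p2, hp2, hp20, hc2⟩ := exists_cos_taylor_remainder 2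
  obtain ⟨q2, hq2, hq20, hs2⟩ := exists_sin_taylor_remainder 2
  obtain ⟨p3, hp3, hp30, hc3⟩ := exists_cos_taylor_remainder 3
  obtain ⟨q3, hq3, hq30, hs3⟩ := exists_sin_taylor_remainder 3
  obtain ⟨p4, hp4, hp40, hc4⟩ := exists_cos_taylor_remainder 4
  obtain ⟨q4, hq4, hq40, hs4⟩ := exists_sin_taylor_remainder 4
  obtain ⟨p5, hp5, hp50, hc5⟩ := exists_cos_taylor_remainder 5
  obtain ⟨q5, hq5, hq50, hs5⟩ := exists_sin_taylor_remainder 5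
  obtain ⟨p6, hp6, hp60, hc6⟩ := exists_cos_taylor_remainder 6
  obtain ⟨q6, hq6, hq60, hs6⟩ := exists_sin_taylor_remainder 6
  have hlim : ContinuousAt (fun v => 45767 / 60480 - 7661099 / 2661120 * v ^ 2
      - 419486489 / 1868106240 * v ^ 4
      + (15 * q1 v - 9 * q2 v - 9 * q3 v + 18 * q4 v - 12 * q5 v + 3 * q6 v)
      + (-41 * p1 v + 33 * p2 v - 3 * p3 v - 24 * p4 v + 20 * p5 v - 5 * p6 v) * v
      + (-24 * q1 v + 33 * q2 v - 12 * q3 v - 12 * q4 v + 12 * q5 v - 3 * q6 v) * v ^ 2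
      + (9031/864 * q1 v - 25231/1512 * q2 v
        - 17671/4032 * q3 v + 17671/3024 * q4 v - 17671/12096 * q5 v) * v ^ 4) 0 := by
    fun_prop
  replace hlim := hlim.tendsto.mono_left (nhdsWithin_le_nhds (s := {0}ᶜ))
  simp only [hp10, hq10, hp20, hq20, hp30, hq30, hp40, hq40, hp50, hq50, hp60, hq60] at hlim
  norm_num at hlim
  refine hlim.congr' ?_
  filter_upwards [self_mem_nhdsWithin] with v hv
  have hv : v ≠ 0 := hv
  unfold eliminatedNumerator
  have hc1 := hc1 v
  have hs1 := hs1 v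
  rw [one_mul] at hc1 hs1
  rw [hc1, hs1, hc2, hs2, hc3, hs3, hc4, hs4, hc5, hs5, hc6, hs6, eq_div_iff (by positivity)]
  ring

theorem tendsto_eliminated_denominator :
    Tendsto (fun v : ℝ => (1 - cos v) ^ 2 * sin v ^ 3 / v ^ 7) (𝓝[≠] 0) (𝓝 (1 / 4)) := by
  obtain ⟨p, hp, -, hc⟩ := exists_cos_taylor_remainder 1
  obtain ⟨q, hq, -, hs⟩ := exists_sin_taylor_remainder 1
  have hlim : ContinuousAt (fun v : ℝ =>
      (1 / 2 - v ^ 2 / 24 + v ^ 4 / 720 - v ^ 6 / 40320 + v ^ 8 / 3628800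
        - v ^ 10 / 479001600 - v ^ 11 * p v) ^ 2
      * (1 - v ^ 2 / 6 + v ^ 4 / 120 - v ^ 6 / 5040 + v ^ 8 / 362880
        - v ^ 10 / 39916800 + v ^ 12 / 6227020800 + v ^ 12 * q v) ^ 3) 0 := by
    fun_prop
  replace hlim := hlim.tendsto.mono_left (nhdsWithin_le_nhds (s := {0}ᶜ))
  norm_num at hlim
  norm_num
  refine hlim.congr' ?_
  filter_upwards [self_mem_nhdsWithin] with v hv
  have hv : v ≠ 0 := hv
  have hc := hc v
  have hs := hs v
  rw [one_mul] at hc hs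
  rw [hc, hs, eq_div_iff (by positivity)]
  ring

/-- The second-order Taylor coefficient at `v = 0` of the `b3` coefficient of
the method with zero phase-lag and zero first and second derivatives of the
phase-lag is `-45767/241920`. -/
theorem b3_zero_PL_PL'_PL''_second_taylor_coeff
    (δ : ℝ) (hδ : 0 < δ) (b0 b1 b2 b3 : ℝ → ℝ)
    (hcond : ∀ v : ℝ, 0 < |v| → |v| < δ →
      N v (b0 v) (b1 v) (b2 v) (b3 v) = 0 ∧
      deriv (fun w => N w (b0 v) (b1 v) (b2 v) (b3 v)) v = 0 ∧
      iteratedDeriv 2 (fun w => N w (b0 v) (b1 v) (b2 v) (b3 v)) v = 0 ∧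
      b0 v = 5 - 2 * b1 v - 2 * b2 v - 2 * b3 v) :
    Filter.Tendsto (fun v : ℝ => (b3 v - 17671 / 12096) / v ^ 2)
      (nhdsWithin 0 {(0 : ℝ)}ᶜ) (nhds (-45767 / 241920)) := by
  have hlim := (tendsto_eliminated_numerator.neg.div
    (tendsto_eliminated_denominator.const_mul 16) (by norm_num))
  rw [show -(45767 / 60480 : ℝ) / (16 * (1 / 4)) = -45767 / 241920 by norm_num] at hlim
  refine hlim.congr' ?_
  have hball : ∀ᶠ v : ℝ in 𝓝[≠] 0, |v| < δ := by
    filter_upwards [nhdsWithin_le_nhds (Metric.ball_mem_nhds (0 : ℝ) hδ)] with v hv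
    simpa using hv
  filter_upwards [self_mem_nhdsWithin, hball,
    tendsto_eliminated_denominator.eventually_ne (by norm_num : (1 / 4 : ℝ) ≠ 0)] with v hv hvδ hne
  have hv : v ≠ 0 := hv
  obtain ⟨h0, h1, h2, h⟩ := hcond v (abs_pos.mpr hv) hvδ
  have key := b3_elimination h0 h1 h2 h
  have hD : (1 - cos v) ^ 2 * sin v ^ 3 ≠ 0 := fun h' => hne (by rw [h', zero_div])
  simp only [Pi.div_apply]
  rw [← key]
  generalize (1 - cos v) ^ 2 * sin v ^ 3 = D at hD
  field_simp
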